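/- Let x, κ, θ, η ∈ ℝ and set σ^OU := (x·𝟙 + κθ·e_1 + η·e_2) ⊗ exp_⧢(−κ·e_1) ∈ T((ℝ²)). Then σ^OU − θ·𝟙 = (x − θ)·exp_⧢(−κ·e_1) + η·(e_2 ⊗ exp_⧢(−κ·e_1)). -/

import Mathlib

/-- Words over the alphabet `{1, …, d}`, modeled as lists over `Fin d`. -/
abbrev Word (d : ℕ) := List (Fin d)

/-- The extended tensor algebra `T((ℝ^d))`, modeled as real-valued functions on words. -/
abbrev Tensor (d : ℕ) := Word d → ℝ

namespace Sig

/-- The unit `𝟙`: the indicator of the empty word. -/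
def unit (d : ℕ) : Tensor d := fun w => if w = [] then 1 else 0

/-- The concatenation product `(ℓ ⊗ p)(w) = Σ_{w = u·v} ℓ(u) p(v)`. -/
def concatProd {d : ℕ} (l p : Tensor d) : Tensor d :=
  fun w => ∑ i ∈ Finset.range (w.length + 1), l (w.take i) * p (w.drop i)

/-- `n`-fold concatenation power, `ℓ^⊗0 = 𝟙`. -/
def concatPow {d : ℕ} (l : Tensor d) : ℕ → Tensor d
  | 0 => unit d
  | n + 1 => concatProd (concatPow l n) l

/-- The letter `e_i`: the indicator of the one-letter word `i`. -/
def letter {d : ℕ} (i : Fin d) : Tensor d := fun w => if w = [i] then 1 else 0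

/-- The shuffle product on `T((ℝ^d))`, the coefficientwise bilinear extension of the
inductive shuffle of words. -/
def shuffle {d : ℕ} : Tensor d → Tensor d → Word d → ℝ
  | l, m, [] => l [] * m []
  | l, m, i :: w => shuffle (fun u => l (i :: u)) m w + shuffle l (fun u => m (i :: u)) w

/-- `n`-fold shuffle power, `ℓ^⧢0 = 𝟙`. -/
def shufflePow {d : ℕ} (l : Tensor d) : ℕ → Tensor d
  | 0 => unit d
  | n + 1 => shuffle (shufflePow l n) l

/-- The resolvent `(𝟙 − q)^{-1} = Σ_{n≥0} q^⊗n`, defined coefficientwise. -/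
noncomputable def resolvent {d : ℕ} (q : Tensor d) : Tensor d :=
  fun w => ∑' n : ℕ, concatPow q n w

/-- The shuffle exponential `exp_⧢(ℓ) = Σ_{n≥0} ℓ^⧢n / n!`, defined coefficientwise. -/
noncomputable def shuffleExp {d : ℕ} (l : Tensor d) : Tensor d :=
  fun w => ∑' n : ℕ, shufflePow l n w / (n.factorial : ℝ)

/-- Right-deconcatenation (projection) by a word `u`: `(ℓ π_u)(w) = ℓ(w·u)`. -/
def proj {d : ℕ} (l : Tensor d) (u : Word d) : Tensor d := fun w => l (w ++ u)

/-- The tensor-algebra representation of the Ornstein–Uhlenbeck process: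
`σ^OU = (x·𝟙 + κθ·e_1 + η·e_2) ⊗ exp_⧢(−κ·e_1)`. -/
noncomputable def sigmaOU (x kappa theta eta : ℝ) : Tensor 2 :=
  concatProd
    (x • unit 2 + (kappa * theta) • letter (0 : Fin 2) + eta • letter (1 : Fin 2))
    (shuffleExp ((-kappa) • letter (0 : Fin 2)))

theorem shuffle_smul_left {d : ℕ} (c : ℝ) (w : Word d) : ∀ l m : Tensor d,
    shuffle (fun u => c * l u) m w = c * shuffle l m w := by
  induction w with
  | nil => intro l m; simp [shuffle, mul_assoc]
  | cons i w ih =>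
    intro l m
    simp only [shuffle]
    rw [ih (fun u => l (i :: u)) m, ih l, mul_add]

theorem shuffle_zero_right {d : ℕ} (w : Word d) : ∀ l : Tensor d,
    shuffle l (fun _ => 0) w = 0 := by
  induction w with
  | nil => intro l; simp [shuffle]
  | cons i w ih => intro l; simp only [shuffle]; rw [ih, ih, add_zero]

theorem shuffle_zero_left {d : ℕ} (w : Word d) : ∀ l : Tensor d,
    shuffle (fun _ => 0) l w = 0 := by
  induction w with
  | nil => intro l; simp [shuffle]
  | cons i w ih => intro l; simp only [shuffle]; rw [ih, ih, add_zero]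

theorem shuffle_unit_right {d : ℕ} (c : ℝ) (w : Word d) : ∀ l : Tensor d,
    shuffle l (fun u => c * unit d u) w = c * l w := by
  induction w with
  | nil => intro l; simp [shuffle, unit, mul_comm]
  | cons i w ih =>
    intro l
    have h0 : (fun u => c * unit d (i :: u)) = fun _ => 0 := by funext u; simp [unit]
    simp only [shuffle]
    rw [ih, h0, shuffle_zero_right, add_zero]

theorem shufflePow_cons {d : ℕ} (c : ℝ) (j i : Fin d) (n : ℕ) : ∀ w : Word d,
    shufflePow (c • letter j) (n + 1) (i :: w) =
      ((n : ℝ) + 1) * (if i = j then c else 0) * shufflePow (c • letter j) n w := by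
  have hD : (fun u => (c • letter j : Tensor d) (i :: u)) =
      fun u => (if i = j then c else 0) * unit d u := by
    funext u
    by_cases h : i = j <;> by_cases h' : u = [] <;> simp [letter, unit, h, h']
  induction n with
  | zero =>
    intro w
    have h0 : (fun u => unit d (i :: u)) = fun _ => 0 := by funext u; simp [unit]
    simp only [shufflePow, shuffle]
    rw [hD, shuffle_unit_right, h0, shuffle_zero_left]
    simp
  | succ n ih =>
    intro w
    rw [shufflePow, shuffle, hD, shuffle_unit_right]
    rw [funext ih, shuffle_smul_left]
    rw [show shuffle (shufflePow (c • letter j) n) (c • letter j) w =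
      shufflePow (c • letter j) (n + 1) w from rfl]
    push_cast
    ring

theorem term_succ_cons {d : ℕ} (c : ℝ) (j i : Fin d) (w : Word d) (n : ℕ) :
    shufflePow (c • letter j) (n + 1) (i :: w) / ((n + 1).factorial : ℝ) =
      (if i = j then c else 0) * (shufflePow (c • letter j) n w / (n.factorial : ℝ)) := by
  rw [shufflePow_cons, Nat.factorial_succ]
  have h1 : ((n : ℝ) + 1) ≠ 0 := by positivity
  have h2 : (n.factorial : ℝ) ≠ 0 := by positivity
  push_cast
  field_simp

theorem term_succ_nil {d : ℕ} (c : ℝ) (j : Fin d) (n : ℕ) :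
    shufflePow (c • letter j) (n + 1) [] / ((n + 1).factorial : ℝ) = 0 := by
  simp [shufflePow, shuffle, letter]

theorem summable_term {d : ℕ} (c : ℝ) (j : Fin d) (w : Word d) :
    Summable fun n : ℕ => shufflePow (c • letter j) n w / (n.factorial : ℝ) := by
  induction w with
  | nil =>
    rw [← summable_nat_add_iff 1]
    simp only [term_succ_nil]
    exact summable_zero
  | cons i w ih =>
    rw [← summable_nat_add_iff 1]
    simp only [term_succ_cons]
    exact ih.mul_left _

theorem shuffleExp_nil {d : ℕ} (c : ℝ) (j : Fin d) :
    shuffleExp (c • letter j) [] = 1 := by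
  unfold shuffleExp
  rw [(summable_term c j []).tsum_eq_zero_add]
  simp only [term_succ_nil]
  simp [shufflePow, unit]

theorem shuffleExp_cons {d : ℕ} (c : ℝ) (j i : Fin d) (w : Word d) :
    shuffleExp (c • letter j) (i :: w) =
      (if i = j then c else 0) * shuffleExp (c • letter j) w := by
  unfold shuffleExp
  rw [(summable_term c j (i :: w)).tsum_eq_zero_add]
  simp only [term_succ_cons]
  rw [tsum_mul_left]
  simp [shufflePow, unit]

theorem concatProd_nil {d : ℕ} (l E : Tensor d) : concatProd l E [] = l [] * E [] := by
  simp [concatProd]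

theorem concatProd_cons {d : ℕ} (l E : Tensor d) (i : Fin d) (w : Word d)
    (hl : ∀ a b u, l (a :: b :: u) = 0) :
    concatProd l E (i :: w) = l [] * E (i :: w) + l [i] * E w := by
  unfold concatProd
  rw [Finset.sum_range_succ', List.length_cons, Finset.sum_range_succ', Finset.sum_eq_zero]
  · simp; ring
  · intro k hk
    cases w with
    | nil => simp at hk
    | cons b w => simp [hl]

/-- `σ^OU − θ·𝟙 = (x − θ)·exp_⧢(−κ·e_1) + η·(e_2 ⊗ exp_⧢(−κ·e_1))`. -/
theorem sigmaOU_sub_theta (x kappa theta eta : ℝ) :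
    sigmaOU x kappa theta eta - theta • unit 2 =
      (x - theta) • shuffleExp ((-kappa) • letter (0 : Fin 2)) +
        eta • concatProd (letter (1 : Fin 2)) (shuffleExp ((-kappa) • letter (0 : Fin 2))) := by
  funext w
  cases w with
  | nil =>
    simp only [sigmaOU, Pi.sub_apply, Pi.add_apply, Pi.smul_apply, smul_eq_mul, concatProd_nil, shuffleExp_nil]
    simp [unit, letter]
  | cons i w =>
    simp only [sigmaOU, Pi.sub_apply, Pi.add_apply, Pi.smul_apply, smul_eq_mul]
    rw [concatProd_cons _ _ _ _ (by intros; simp [unit, letter]),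
      concatProd_cons _ _ _ _ (by intros; simp [letter]), shuffleExp_cons]
    fin_cases i <;> simp [unit, letter] <;> ring

end Sig
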